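/- Let ρ ∈ (1/2, 1/√2), λ = √(4ρ² − 1), and β > 0. With G(ρ,δ) and S(ρ,δ) as defined below, lim_{δ→0⁺} δ⁻²·(S(ρ,δ)/G(ρ,δ))·(1/√(2πβ)) = (1/√(πβ))·(1 − λ − ρ²·(π − 4·arctan λ))⁻¹. -/

import Mathlib

open MeasureTheory Real Filter

noncomputable def lam (ρ : ℝ) : ℝ := Real.sqrt (4*ρ^2 - 1)

/-- Area of the ball cell. -/
noncomputable def A (ρ : ℝ) : ℝ :=
  1 - lam ρ - ρ^2 * (Real.pi - 4 * Real.arctan (lam ρ))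

noncomputable def R (ρ δ : ℝ) : ℝ :=
  Real.arctan (lam ρ)
    - Real.arctan ((lam ρ + 2*δ)/Real.sqrt (1 - 4*δ*(lam ρ + δ)))

/-- Volume of the ball-piston configuration space. -/
noncomputable def G (ρ δ : ℝ) : ℝ :=
  (lam ρ + 2*δ) * A ρ
    - (1/24) * (2*δ*(lam ρ + 4*δ)
        + (1 - Real.sqrt (1 - 4*δ*(lam ρ + δ)))
            * (2 + 4*δ*(lam ρ + δ) + 3*(lam ρ)^2))
    - (1/2) * ρ^2 * (lam ρ + 2*δ) * R ρ δ

/-- Area of the ball-piston collision surface. -/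
noncomputable def S (ρ δ : ℝ) : ℝ :=
  (1/(2*Real.sqrt 2))
      * ((lam ρ + 2*δ) * (2 - Real.sqrt (1 - 4*δ*(lam ρ + δ))) - lam ρ)
    + Real.sqrt 2 * ρ^2 * R ρ δ


lemma lam_facts (ρ : ℝ) (h1 : 1/2 < ρ) (h2 : ρ < 1/Real.sqrt 2) :
    0 < lam ρ ∧ lam ρ < 1 ∧ lam ρ ^ 2 = 4*ρ^2 - 1 := by
  have hs : Real.sqrt 2 ^ 2 = 2 := Real.sq_sqrt (by norm_num)
  have h3 : ρ^2 < 1/2 := by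
    have : ρ^2 < (1/Real.sqrt 2)^2 := by
      apply pow_lt_pow_left₀ h2 (by linarith) (by norm_num)
    rwa [div_pow, hs, one_pow] at this
  have h4 : 0 < 4*ρ^2 - 1 := by nlinarith
  refine ⟨Real.sqrt_pos.mpr h4, ?_, Real.sq_sqrt h4.le⟩
  unfold lam
  rw [Real.sqrt_lt' (by norm_num)]
  linarith

lemma A_pos (ρ : ℝ) (h1 : 1/2 < ρ) (h2 : ρ < 1/Real.sqrt 2) : 0 < A ρ := by
  obtain ⟨hl0, hl1, hsq⟩ := lam_facts ρ h1 h2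
  unfold A
  set l := lam ρ
  have hy0 : 0 < (1-l)/(1+l) := div_pos (by linarith) (by linarith)
  have hlt : l * ((1-l)/(1+l)) < 1 := by
    rw [← mul_div_assoc, div_lt_one (by linarith)]; nlinarith
  have h := Real.arctan_add hlt
  have e : (l + (1-l)/(1+l)) / (1 - l * ((1-l)/(1+l))) = 1 := by
    rw [div_eq_one_iff_eq (by linarith)]
    field_simp; ring
  rw [e, Real.arctan_one] at h
  have h5 : Real.arctan ((1-l)/(1+l)) ≤ (1-l)/(1+l) := by
    have := Real.le_tan (Real.arctan_nonneg.2 hy0.le) (Real.arctan_lt_pi_div_two ((1-l)/(1+l)))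
    rwa [Real.tan_arctan] at this
  have h6 : (1+l^2) * ((1-l)/(1+l)) < 1 - l := by
    rw [← mul_div_assoc, div_lt_iff₀ (by linarith)]
    nlinarith [mul_pos (mul_pos hl0 (sub_pos.2 hl1)) (sub_pos.2 hl1)]
  have h7 : Real.pi - 4 * Real.arctan l = 4 * Real.arctan ((1-l)/(1+l)) := by linarith
  rw [h7]
  have h8 : (1+l^2) * Real.arctan ((1-l)/(1+l)) ≤ (1+l^2) * ((1-l)/(1+l)) :=
    mul_le_mul_of_nonneg_left h5 (by positivity)
  have h9 : ρ^2 * (4 * Real.arctan ((1-l)/(1+l))) = (1+l^2) * Real.arctan ((1-l)/(1+l)) := by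
    rw [hsq]; ring
  linarith

lemma S_deriv (ρ δ : ℝ) (hρ : 0 < ρ) (hsq : lam ρ ^ 2 = 4*ρ^2 - 1)
    (hp : 0 < 1 - 4*δ*(lam ρ + δ)) :
    HasDerivAt (S ρ) (Real.sqrt 2 * (1 - Real.sqrt (1 - 4*δ*(lam ρ + δ)))) δ := by
  unfold S R
  set l := lam ρ
  have hu : HasDerivAt (fun δ : ℝ => l + 2*δ) 2 δ := by
    simpa using ((hasDerivAt_id δ).const_mul 2).const_add l
  have hq : HasDerivAt (fun δ : ℝ => 1 - 4*δ*(l + δ)) (-(4*(l+2*δ))) δ := by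
    have h := ((((hasDerivAt_id δ).const_mul 4).mul ((hasDerivAt_id δ).const_add l)).const_sub 1)
    refine h.congr_deriv ?_
    simp; ring
  have hs := hq.sqrt hp.ne'
  have hspos : 0 < Real.sqrt (1 - 4*δ*(l + δ)) := Real.sqrt_pos.mpr hp
  have hs2 : Real.sqrt (1 - 4*δ*(l + δ))^2 = 1 - 4*δ*(l + δ) := Real.sq_sqrt hp.le
  have hR := ((hu.div hs hspos.ne').arctan).const_sub (Real.arctan l)
  have hF := (((hu.mul (hs.const_sub 2)).sub_const l).const_mul (1/(2*Real.sqrt 2))).add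
    (hR.const_mul (Real.sqrt 2 * ρ^2))
  refine hF.congr_deriv ?_
  simp only [Pi.div_apply]
  have h22 : Real.sqrt 2 ^ 2 = 2 := Real.sq_sqrt (by norm_num)
  have h2p : 0 < Real.sqrt 2 := by positivity
  generalize Real.sqrt 2 = w at *
  clear hF hR hs
  generalize Real.sqrt (1 - 4*δ*(l + δ)) = s at *
  obtain ⟨u, hu'⟩ : ∃ u, u = l + 2*δ := ⟨_, rfl⟩
  rw [← hu']
  have hus : s^2 + u^2 = 4*ρ^2 := by rw [hs2, hu']; linarith
  have e1 : 1 / (1 + (u/s)^2) = s^2/(4*ρ^2) := by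
    rw [← hus]; field_simp
  have e2 : (2 * s - u * (-(4*u)/(2*s))) / s^2 = 2*(4*ρ^2)/s^3 := by
    rw [← hus]; field_simp; ring
  rw [e1, e2]
  have e3 : s^2/(4*ρ^2) * (2*(4*ρ^2)/s^3) = 2/s := by field_simp
  rw [e3]
  have e4 : ρ^2 = (s^2+u^2)/4 := by linarith
  rw [e4]
  have e5 : 1/(2*w) = w/4 := by
    rw [div_eq_div_iff (by positivity) (by norm_num)]; nlinarith
  rw [e5]
  field_simp
  ring

lemma S_lim (ρ : ℝ) (h1 : 1/2 < ρ) (h2 : ρ < 1/Real.sqrt 2) :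
    Tendsto (fun δ : ℝ => S ρ δ / δ^2) (nhdsWithin 0 (Set.Ioi 0))
      (nhds (Real.sqrt 2 * lam ρ)) := by
  obtain ⟨hl0, hl1, hsq⟩ := lam_facts ρ h1 h2
  have hc : Continuous (fun δ : ℝ => 1 - 4*δ*(lam ρ + δ)) := by fun_prop
  have hev0 : ∀ᶠ δ in nhds (0:ℝ), 0 < 1 - 4*δ*(lam ρ + δ) :=
    hc.continuousAt.eventually (lt_mem_nhds (by simp))
  have hev := hev0.filter_mono (nhdsWithin_le_nhds (s := Set.Ioi 0))
  have hpos : ∀ᶠ δ in nhdsWithin (0:ℝ) (Set.Ioi 0), 0 < δ := self_mem_nhdsWithin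
  have hS0 : S ρ 0 = 0 := by simp [S, R]; ring
  refine HasDerivAt.lhopital_zero_nhdsGT (f := S ρ) (g := fun δ => δ^2)
    (f' := fun δ => Real.sqrt 2 * (1 - Real.sqrt (1 - 4*δ*(lam ρ + δ))))
    (g' := fun δ => 2*δ) ?_ ?_ ?_ ?_ ?_ ?_
  · filter_upwards [hev] with δ h using S_deriv ρ δ (by linarith) hsq h
  · filter_upwards with δ
    simpa using hasDerivAt_pow 2 δ
  · filter_upwards [hpos] with δ h
    positivity
  · have := (S_deriv ρ 0 (by linarith) hsq (by simp)).continuousAt.tendsto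
    rw [hS0] at this
    exact this.mono_left nhdsWithin_le_nhds
  · have : Tendsto (fun δ : ℝ => δ^2) (nhds 0) (nhds (0^2)) := (continuous_pow 2).tendsto 0
    rw [zero_pow (by norm_num)] at this
    exact this.mono_left nhdsWithin_le_nhds
  · have hc2 : Continuous (fun δ : ℝ =>
        Real.sqrt 2 * (2*(lam ρ + δ)) / (1 + Real.sqrt (1 - 4*δ*(lam ρ + δ)))) := by
      apply Continuous.div (by fun_prop) (by fun_prop)
      intro x; positivity
    have ht := hc2.tendsto 0
    have e : Real.sqrt 2 * (2*(lam ρ + 0)) / (1 + Real.sqrt (1 - 4*0*(lam ρ + 0)))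
        = Real.sqrt 2 * lam ρ := by simp; ring
    rw [e] at ht
    refine (ht.mono_left nhdsWithin_le_nhds).congr' ?_
    filter_upwards [hev, hpos] with δ h hd
    have hs2 := Real.sq_sqrt h.le
    have hs0 := Real.sqrt_nonneg (1 - 4*δ*(lam ρ + δ))
    generalize Real.sqrt (1 - 4*δ*(lam ρ + δ)) = s at *
    rw [div_eq_div_iff (by positivity) (by positivity)]
    linear_combination (Real.sqrt 2) * hs2

lemma G_lim (ρ : ℝ) : Tendsto (G ρ) (nhdsWithin 0 (Set.Ioi 0)) (nhds (lam ρ * A ρ)) := by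
  have h : ContinuousAt (G ρ) 0 := by
    unfold G R
    have hd : ContinuousAt (fun δ : ℝ => (lam ρ + 2*δ)/Real.sqrt (1 - 4*δ*(lam ρ + δ))) 0 := by
      apply ContinuousAt.div (by fun_prop) (by fun_prop)
      simp
    have ha := Real.continuous_arctan.continuousAt.comp hd
    have ha' : ContinuousAt (fun δ : ℝ =>
      Real.arctan ((lam ρ + 2*δ)/Real.sqrt (1 - 4*δ*(lam ρ + δ)))) 0 := ha
    fun_prop
  have e : G ρ 0 = lam ρ * A ρ := by simp [G, R]
  rw [← e]
  exact h.tendsto.mono_left nhdsWithin_le_nhds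

/-- The rare-interaction limit of the rescaled canonical average of the
collision rate, `δ⁻²·(S/G)·(1/√(2πβ))`, which provides an approximation of the
heat conductivity of the ball-piston gas. -/
theorem stmt_19 (ρ β : ℝ) (h1 : 1/2 < ρ) (h2 : ρ < 1/Real.sqrt 2) (hβ : 0 < β) :
    Tendsto (fun δ : ℝ =>
        (δ^2)⁻¹ * (S ρ δ / G ρ δ) * (1/Real.sqrt (2*Real.pi*β)))
      (nhdsWithin 0 (Set.Ioi 0))
      (nhds ((1/Real.sqrt (Real.pi*β))
        * (1 - lam ρ - ρ^2 * (Real.pi - 4 * Real.arctan (lam ρ)))⁻¹)) := by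

  obtain ⟨hl0, hl1, hsq⟩ := lam_facts ρ h1 h2
  have hA := A_pos ρ h1 h2
  have h := ((S_lim ρ h1 h2).div (G_lim ρ) (mul_pos hl0 hA).ne').mul_const
    (1/Real.sqrt (2*Real.pi*β))
  have e : Real.sqrt 2 * lam ρ / (lam ρ * A ρ) * (1/Real.sqrt (2*Real.pi*β))
      = (1/Real.sqrt (Real.pi*β))
        * (1 - lam ρ - ρ^2 * (Real.pi - 4 * Real.arctan (lam ρ)))⁻¹ := by
    change _ = (1/Real.sqrt (Real.pi*β)) * (A ρ)⁻¹
    rw [mul_assoc 2, Real.sqrt_mul (by norm_num : (0:ℝ) ≤ 2)]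
    have : 0 < Real.sqrt (Real.pi*β) := Real.sqrt_pos.mpr (mul_pos Real.pi_pos hβ)
    field_simp
  rw [e] at h
  refine h.congr fun δ => ?_
  simp only [Pi.div_apply]
  congr 1
  ring
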